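/- Suppose (T_n)_{n≥0}, (U_n)_{n≥0} and (a_n) are elements of a commutative ring satisfying the three-term-type recursions T_{n+1} = T_n·t_n − U_{n-1}, and U_n = T_n·u_n − a_{n-1}·T_{n-1} (with T_0 = 1, U_{-1} = 0, T_{-1} = 0), for given commuting elements t_n, u_n, a_n. Then T_n equals the determinant of the n×n matrix M with M_{i,i} = t_{n-i}, M_{i,i+1} = u_{n-i-1}, M_{i,i+2} = a_{n-i-2}, M_{i+1,i} = 1 and all other entries 0. -/

import Mathlib

/-- Banded Hessenberg matrix: (0-indexed version of) M_{i,i} = t_{n-i},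
M_{i,i+1} = u_{n-i-1}, M_{i,i+2} = a_{n-i-2}, M_{i+1,i} = 1, zeros elsewhere. -/
def fusionM {R : Type*} [CommRing R] (t u a : ℕ → R) (n : ℕ) :
    Matrix (Fin n) (Fin n) R :=
  Matrix.of fun i j =>
    if (j : ℕ) = (i : ℕ) then t (n - 1 - i)
    else if (j : ℕ) = (i : ℕ) + 1 then u (n - 2 - i)
    else if (j : ℕ) = (i : ℕ) + 2 then a (n - 3 - i)
    else if (i : ℕ) = (j : ℕ) + 1 then 1
    else 0

/-- Deleting the first row and column of the banded matrix gives the next smaller one. -/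
theorem fusionM_submatrix_succ {R : Type*} [CommRing R] (t u a : ℕ → R) (n : ℕ) :
    (fusionM t u a (n + 1)).submatrix Fin.succ Fin.succ = fusionM t u a n := by
  ext i j
  have h₁ : n + 1 - 1 - ((i : ℕ) + 1) = n - 1 - i := by lia
  have h₂ : n + 1 - 2 - ((i : ℕ) + 1) = n - 2 - i := by lia
  have h₃ : n + 1 - 3 - ((i : ℕ) + 1) = n - 3 - i := by lia
  simp only [fusionM, Matrix.submatrix_apply, Matrix.of_apply, Fin.val_succ, h₁, h₂, h₃]
  split_ifs <;> first | rfl | lia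

/-- Expansion along the first column of the banded matrix with its first row replaced. -/
theorem det_updateRow_fusionM {R : Type*} [CommRing R] (t u a : ℕ → R) (k : ℕ) (r : ℕ → R) :
    ((fusionM t u a (k + 2)).updateRow 0 (fun j => r j)).det =
      r 0 * (fusionM t u a (k + 1)).det
        - ((fusionM t u a (k + 1)).updateRow 0 (fun j => r (j + 1))).det := by
  rw [Matrix.det_succ_column_zero, Fin.sum_univ_succ, Fin.sum_univ_succ, Finset.sum_eq_zero]
  · have h₀ : ((fusionM t u a (k + 2)).updateRow 0 (fun j => r j)).submatrix
        (Fin.succAbove 0) Fin.succ = fusionM t u a (k + 1) := by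
      rw [← fusionM_submatrix_succ t u a (k + 1)]
      ext i j
      simp
    have h₁ : ((fusionM t u a (k + 2)).updateRow 0 (fun j => r j)).submatrix
        (Fin.succAbove (Fin.succ 0)) Fin.succ =
          (fusionM t u a (k + 1)).updateRow 0 (fun j => r (j + 1)) := by
      rw [← fusionM_submatrix_succ t u a (k + 1)]
      ext i j
      cases i using Fin.cases with
      | zero => simp
      | succ i => simp [Matrix.updateRow_ne, Fin.succ_ne_zero]
    have h₂ : fusionM t u a (k + 2) (Fin.succ 0) 0 = 1 := by
      simp [fusionM]
    rw [h₀, h₁, Matrix.updateRow_self, Matrix.updateRow_ne (Fin.succ_ne_zero _), h₂]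
    simp [sub_eq_add_neg]
  · intro i _
    rw [Matrix.updateRow_ne (Fin.succ_ne_zero _)]
    simp [fusionM]

/-- Expansion along a first row that vanishes off the diagonal. -/
theorem det_updateRow_fusionM_of_eq_zero {R : Type*} [CommRing R] (t u a : ℕ → R) (n : ℕ)
    (r : ℕ → R) (hr : ∀ j, r (j + 1) = 0) :
    ((fusionM t u a (n + 1)).updateRow 0 (fun j => r j)).det =
      r 0 * (fusionM t u a n).det := by
  rw [Matrix.det_succ_row_zero, Fin.sum_univ_succ, Finset.sum_eq_zero]
  · have h : ((fusionM t u a (n + 1)).updateRow 0 (fun j => r j)).submatrix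
        Fin.succ (Fin.succAbove 0) = fusionM t u a n := by
      rw [← fusionM_submatrix_succ t u a n]
      ext i j
      simp [Matrix.updateRow_ne, Fin.succ_ne_zero]
    rw [h]
    simp
  · intro j _
    simp [hr]

/-- The four-term recursion for the banded determinants. -/
theorem det_fusionM_add_three {R : Type*} [CommRing R] (t u a : ℕ → R) (n : ℕ) :
    (fusionM t u a (n + 3)).det =
      t (n + 2) * (fusionM t u a (n + 2)).det - (u (n + 1) * (fusionM t u a (n + 1)).det
        - a n * (fusionM t u a n).det) := by
  let r : ℕ → R := fun j =>
    if j = 0 then t (n + 2) else if j = 1 then u (n + 1) else if j = 2 then a n else 0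
  have h : fusionM t u a (n + 3) = (fusionM t u a (n + 3)).updateRow 0 (fun j => r j) := by
    ext i j
    cases i using Fin.cases with
    | zero => simp [fusionM, r]
    | succ i => simp [Matrix.updateRow_ne, Fin.succ_ne_zero]
  rw [h, det_updateRow_fusionM, det_updateRow_fusionM t u a n (fun j => r (j + 1)),
    det_updateRow_fusionM_of_eq_zero t u a n (fun j => r (j + 1 + 1)) (fun j => by simp [r])]
  simp [r]

/-- Abstract determinantal solution of the su(3) fusion hierarchy: if
T_{n+1} = T_n t_n − U_{n-1} and U_n = T_n u_n − a_{n-1} T_{n-1}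
(with T_0 = 1 and the conventions U_{-1} = 0, T_{-1} = 0 built into the
initial cases), then T_n is the banded Hessenberg determinant. -/
theorem hessenberg_determinant {R : Type*} [CommRing R]
    (T U : ℕ → R) (t u a : ℕ → R)
    (hT0 : T 0 = 1)
    (hT1 : T 1 = T 0 * t 0)
    (hTrec : ∀ n : ℕ, 1 ≤ n → T (n + 1) = T n * t n - U (n - 1))
    (hU0 : U 0 = T 0 * u 0)
    (hUrec : ∀ n : ℕ, 1 ≤ n → U n = T n * u n - a (n - 1) * T (n - 1)) :
    ∀ n : ℕ, T n = (fusionM t u a n).det := by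
  intro n
  induction n using Nat.strong_induction_on with
  | _ n ih =>
    match n, ih with
    | 0, _ => simp [hT0]
    | 1, _ => simp [fusionM, hT1, hT0]
    | 2, _ =>
      rw [hTrec 1 le_rfl, hT1, Nat.sub_self, hU0, hT0, Matrix.det_fin_two]
      simp [fusionM, mul_comm]
    | n + 3, ih =>
      rw [det_fusionM_add_three, ← ih (n + 2) (by lia), ← ih (n + 1) (by lia),
        ← ih n (by lia), hTrec (n + 2) (by lia), Nat.add_sub_cancel (n + 1) 1,
        hUrec (n + 1) (by lia), Nat.add_sub_cancel]
      ring
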